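/- (Flatness equals projectivity) Let φ be a consistent formula of propositional team logic (i.e., X ⊨ φ for some nonempty team X) whose variables are among p₁,…,pₙ. Then the following are equivalent: (i) φ ≡ Θ_X for some nonempty team X on {p₁,…,pₙ}; (ii) φ is flat; (iii) φ is F-projective. -/

import Mathlib

inductive PTForm : Type
  | var : ℕ → PTForm
  | bot : PTForm
  | top : PTForm
  | neg : PTForm → PTForm
  | conj : PTForm → PTForm → PTForm
  | tensor : PTForm → PTForm → PTForm
  | disj : PTForm → PTForm → PTForm
  | impl : PTForm → PTForm → PTForm
  | dep : List PTForm → PTForm → PTForm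

abbrev Val := ℕ → Bool
abbrev Team := Set Val

def PTSat : Team → PTForm → Prop
  | X, .var n => ∀ v ∈ X, v n = true
  | X, .bot => X = ∅
  | _, .top => True
  | X, .neg φ => ∀ v ∈ X, ¬ PTSat {v} φ
  | X, .conj φ ψ => PTSat X φ ∧ PTSat X ψ
  | X, .tensor φ ψ => ∃ Y Z, X = Y ∪ Z ∧ PTSat Y φ ∧ PTSat Z ψ
  | X, .disj φ ψ => PTSat X φ ∨ PTSat X ψ
  | X, .impl φ ψ => ∀ Y ⊆ X, PTSat Y φ → PTSat Y ψ
  | X, .dep l ψ => ∀ Y ⊆ X,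
      (∀ φ ∈ l, PTSat Y φ ∨ (∀ v ∈ Y, ¬ PTSat {v} φ)) →
      (PTSat Y ψ ∨ (∀ v ∈ Y, ¬ PTSat {v} ψ))

def PTValid (φ : PTForm) : Prop := ∀ X : Team, PTSat X φ
def PTConseq (φ ψ : PTForm) : Prop := ∀ X : Team, PTSat X φ → PTSat X ψ
def PTEquiv (φ ψ : PTForm) : Prop := ∀ X : Team, PTSat X φ ↔ PTSat X ψ
def PTSetConseq (Γ : Set PTForm) (φ : PTForm) : Prop :=
  ∀ X : Team, (∀ ψ ∈ Γ, PTSat X ψ) → PTSat X φ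
def Flat (φ : PTForm) : Prop :=
  ∀ X : Team, PTSat X φ ↔ ∀ v ∈ X, PTSat {v} φ

/-- All propositional variables of a formula are among `p_0, …, p_{n-1}`. -/
def VarsBelow (n : ℕ) : PTForm → Prop
  | .var m => m < n
  | .bot => True
  | .top => True
  | .neg φ => VarsBelow n φ
  | .conj φ ψ => VarsBelow n φ ∧ VarsBelow n ψ
  | .tensor φ ψ => VarsBelow n φ ∧ VarsBelow n ψ
  | .disj φ ψ => VarsBelow n φ ∧ VarsBelow n ψ
  | .impl φ ψ => VarsBelow n φ ∧ VarsBelow n ψ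
  | .dep l ψ => (∀ φ ∈ l, VarsBelow n φ) ∧ VarsBelow n ψ

/-- The restriction of a valuation to the variables `p_0, …, p_{n-1}`. -/
def restrict (n : ℕ) (v : Val) : Fin n → Bool := fun i => v i.val

/-- The team of all valuations whose restriction to `p_0, …, p_{n-1}` lies in
a given team on those variables. -/
def liftTeam (n : ℕ) (Y : Set (Fin n → Bool)) : Team :=
  {w : Val | restrict n w ∈ Y}

/-- Finite intuitionistic disjunction (`⊥` for the empty list). -/
def bigDisj (l : List PTForm) : PTForm := l.foldr .disj .bot

/-- Finite tensor disjunction (`⊥` for the empty list). -/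
def bigTensor (l : List PTForm) : PTForm := l.foldr .tensor .bot

/-- The conjunction `p_0^{v(p_0)} ∧ … ∧ p_{n-1}^{v(p_{n-1})}`,
where `p¹ = p` and `p⁰ = ¬p`. -/
def literal (n : ℕ) (v : Fin n → Bool) : PTForm :=
  (List.finRange n).foldr
    (fun i acc => .conj (if v i then .var i.val else .neg (.var i.val)) acc) .top

open Classical in
/-- `Θ_X := ¬¬⋁_{v∈X} (p_0^{v(p_0)} ∧ … ∧ p_{n-1}^{v(p_{n-1})})` for a nonempty
team `X` on `p_0, …, p_{n-1}`, and `Θ_∅ := ⊥`. -/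
noncomputable def Theta (n : ℕ) (X : Set (Fin n → Bool)) : PTForm :=
  if X = ∅ then .bot
  else .neg (.neg (bigDisj (X.toFinite.toFinset.toList.map (literal n))))

/-- `Θ⊗_X := ⨂_{v∈X} (p_0^{v(p_0)} ∧ … ∧ p_{n-1}^{v(p_{n-1})})`
(the tensor normal form; `⊥` for `X = ∅`). -/
noncomputable def ThetaTensor (n : ℕ) (X : Set (Fin n → Bool)) : PTForm :=
  bigTensor (X.toFinite.toFinset.toList.map (literal n))

abbrev Subst := ℕ → PTForm

def applySubst (σ : Subst) : PTForm → PTForm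
  | .var n => σ n
  | .bot => .bot
  | .top => .top
  | .neg φ => .neg (applySubst σ φ)
  | .conj φ ψ => .conj (applySubst σ φ) (applySubst σ ψ)
  | .tensor φ ψ => .tensor (applySubst σ φ) (applySubst σ ψ)
  | .disj φ ψ => .disj (applySubst σ φ) (applySubst σ ψ)
  | .impl φ ψ => .impl (applySubst σ φ) (applySubst σ ψ)
  | .dep l ψ => .dep (l.attach.map (fun x => applySubst σ x.1)) (applySubst σ ψ)
decreasing_by
  all_goals simp_wf
  all_goals first
    | (have := List.sizeOf_lt_of_mem x.2; omega)
    | omega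

def FlatSubst (σ : Subst) : Prop := ∀ n : ℕ, Flat (σ n)

open Classical in
noncomputable def valSub (σ : Subst) (v : Val) : Val :=
  fun p => if PTSat {v} (σ p) then true else false

noncomputable def teamSub (σ : Subst) (X : Team) : Team := valSub σ '' X

/-- A formula is F-projective if some flat substitution unifies it and is,
modulo the formula, the identity on variables. -/
def FProjective (φ : PTForm) : Prop :=
  ∃ σ : Subst, FlatSubst σ ∧ PTValid (applySubst σ φ) ∧
    ∀ p : ℕ,
      (∀ X : Team, PTSat X φ → PTSat X (σ p) → PTSat X (.var p)) ∧
      (∀ X : Team, PTSat X φ → PTSat X (.var p) → PTSat X (σ p))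

/-- Prucnal's substitution determined by a formula `θ` and a valuation `v` on
`p_0, …, p_{n-1}`: `σ(p) = θ ∧ p` if `v(p) = 0` and `σ(p) = θ → p` if
`v(p) = 1` (identity outside the domain of `v`). -/
def prucnal (θ : PTForm) (n : ℕ) (v : Fin n → Bool) : Subst :=
  fun p => if h : p < n then
      (if v ⟨p, h⟩ then .impl θ (.var p) else .conj θ (.var p))
    else .var p

/-- The variant of Prucnal's substitution used for the tensor normal form:
`σ(p) = θ ∧ p` if `v(p) = 0` and `σ(p) = ¬θ ⊗ p` if `v(p) = 1`. -/
def prucnalT (θ : PTForm) (n : ℕ) (v : Fin n → Bool) : Subst :=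
  fun p => if h : p < n then
      (if v ⟨p, h⟩ then .tensor (.neg θ) (.var p) else .conj θ (.var p))
    else .var p

/-- A formula contains no dependence atoms and no intuitionistic disjunction. -/
def IsClassical : PTForm → Prop
  | .var _ => True
  | .bot => True
  | .top => True
  | .neg φ => IsClassical φ
  | .conj φ ψ => IsClassical φ ∧ IsClassical ψ
  | .tensor φ ψ => IsClassical φ ∧ IsClassical ψ
  | .disj _ _ => False
  | .impl φ ψ => IsClassical φ ∧ IsClassical ψ
  | .dep _ _ => False

/-- Classical truth-table satisfaction by a single valuation, reading `⊗` as
classical disjunction. -/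
def CSat (v : Val) : PTForm → Prop
  | .var n => v n = true
  | .bot => False
  | .top => True
  | .neg φ => ¬ CSat v φ
  | .conj φ ψ => CSat v φ ∧ CSat v ψ
  | .tensor φ ψ => CSat v φ ∨ CSat v ψ
  | .disj φ ψ => CSat v φ ∨ CSat v ψ
  | .impl φ ψ => CSat v φ → CSat v ψ
  | .dep _ _ => True

/-- Formulas of propositional dependence logic (PD): atoms `p`, `¬p`, `⊥`, `⊤`,
dependence atoms with variable arguments, conjunction and tensor. -/
inductive PDForm : Type
  | pos : ℕ → PDForm
  | negv : ℕ → PDForm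
  | bot : PDForm
  | top : PDForm
  | dep : List ℕ → ℕ → PDForm
  | conj : PDForm → PDForm → PDForm
  | tensor : PDForm → PDForm → PDForm

/-- The embedding of PD formulas into PT formulas. -/
def PDForm.toPT : PDForm → PTForm
  | .pos n => .var n
  | .negv n => .neg (.var n)
  | .bot => .bot
  | .top => .top
  | .dep l q => .dep (l.map .var) (.var q)
  | .conj φ ψ => .conj φ.toPT ψ.toPT
  | .tensor φ ψ => .tensor φ.toPT ψ.toPT

/-- The syntactic (De Morgan) negation `φ~` of a PD formula. -/
def PDForm.synNeg : PDForm → PDForm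
  | .pos n => .negv n
  | .negv n => .pos n
  | .bot => .top
  | .top => .bot
  | .dep _ _ => .bot
  | .conj φ ψ => .tensor φ.synNeg ψ.synNeg
  | .tensor φ ψ => .conj φ.synNeg ψ.synNeg

/-- Structural induction on formulas, with an induction hypothesis for every argument of a
dependence atom. -/
theorem PTForm.induction {P : PTForm → Prop}
    (var : ∀ p, P (.var p)) (bot : P .bot) (top : P .top)
    (neg : ∀ φ, P φ → P (.neg φ))
    (conj : ∀ φ ψ, P φ → P ψ → P (.conj φ ψ))
    (tensor : ∀ φ ψ, P φ → P ψ → P (.tensor φ ψ))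
    (disj : ∀ φ ψ, P φ → P ψ → P (.disj φ ψ))
    (impl : ∀ φ ψ, P φ → P ψ → P (.impl φ ψ))
    (dep : ∀ l ψ, (∀ φ ∈ l, P φ) → P ψ → P (.dep l ψ)) (φ : PTForm) : P φ :=
  PTForm.rec (motive_1 := P) (motive_2 := fun l => ∀ φ ∈ l, P φ)
    var bot top neg conj tensor disj impl dep (by simp)
    (fun _ _ h ht => List.forall_mem_cons.2 ⟨h, ht⟩) φ

theorem PTSat.mono {φ : PTForm} : ∀ {X Y : Team}, PTSat X φ → Y ⊆ X → PTSat Y φ := by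
  induction φ using PTForm.induction with
  | var p => intro X Y h hs; simp only [PTSat] at h ⊢; exact fun v hv => h v (hs hv)
  | bot => intro X Y h hs; simp only [PTSat] at h ⊢; exact Set.subset_eq_empty hs h
  | top => intros; simp only [PTSat]
  | neg φ _ => intro X Y h hs; simp only [PTSat] at h ⊢; exact fun v hv => h v (hs hv)
  | conj φ ψ ihφ ihψ =>
    intro X Y h hs; simp only [PTSat] at h ⊢; exact ⟨ihφ h.1 hs, ihψ h.2 hs⟩
  | tensor φ ψ ihφ ihψ =>
    intro X Y h hs
    simp only [PTSat] at h ⊢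
    obtain ⟨A, B, rfl, hA, hB⟩ := h
    refine ⟨Y ∩ A, Y ∩ B, ?_, ihφ hA Set.inter_subset_right, ihψ hB Set.inter_subset_right⟩
    rw [← Set.inter_union_distrib_left, Set.inter_eq_left.2 hs]
  | disj φ ψ ihφ ihψ =>
    intro X Y h hs; simp only [PTSat] at h ⊢; exact h.imp (ihφ · hs) (ihψ · hs)
  | impl φ ψ _ _ =>
    intro X Y h hs; simp only [PTSat] at h ⊢; exact fun Z hZ => h Z (hZ.trans hs)
  | dep l ψ _ _ =>
    intro X Y h hs; simp only [PTSat] at h ⊢; exact fun Z hZ => h Z (hZ.trans hs)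

theorem ptSat_empty (φ : PTForm) : PTSat ∅ φ := by
  induction φ using PTForm.induction with
  | var p => simp [PTSat]
  | bot => simp [PTSat]
  | top => simp [PTSat]
  | neg φ _ => simp [PTSat]
  | conj φ ψ ihφ ihψ => simp [PTSat, ihφ, ihψ]
  | tensor φ ψ ihφ ihψ => simp only [PTSat]; exact ⟨∅, ∅, by simp, ihφ, ihψ⟩
  | disj φ ψ ihφ _ => simp [PTSat, ihφ]
  | impl φ ψ _ ihψ =>
    simp only [PTSat]; intro Y hY _; rwa [Set.subset_empty_iff.1 hY]
  | dep l ψ _ ihψ =>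
    simp only [PTSat]; intro Y hY _; rw [Set.subset_empty_iff.1 hY]; exact .inl ihψ

/-- On singleton teams, team satisfaction is classical satisfaction. -/
theorem ptSat_singleton_iff {v : Val} {φ : PTForm} : PTSat {v} φ ↔ CSat v φ := by
  induction φ using PTForm.induction with
  | var p => simp [PTSat, CSat]
  | bot => simp [PTSat, CSat]
  | top => simp [PTSat, CSat]
  | neg φ ih => simp [PTSat, CSat, ih]
  | conj φ ψ ihφ ihψ => simp [PTSat, CSat, ihφ, ihψ]
  | tensor φ ψ ihφ ihψ =>
    simp only [PTSat, CSat, ← ihφ, ← ihψ]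
    constructor
    · rintro ⟨A, B, hv, hA, hB⟩
      have hmem : v ∈ A ∪ B := hv ▸ Set.mem_singleton v
      exact hmem.imp (fun h => hA.mono (Set.singleton_subset_iff.2 h))
        (fun h => hB.mono (Set.singleton_subset_iff.2 h))
    · rintro (h | h)
      · exact ⟨{v}, ∅, by simp, h, ptSat_empty ψ⟩
      · exact ⟨∅, {v}, by simp, ptSat_empty φ, h⟩
  | disj φ ψ ihφ ihψ => simp [PTSat, CSat, ihφ, ihψ]
  | impl φ ψ ihφ ihψ =>
    simp only [PTSat, CSat, ← ihφ, ← ihψ]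
    refine ⟨fun h => h {v} subset_rfl, fun h Y hY hφ => ?_⟩
    obtain rfl | rfl := Set.subset_singleton_iff_eq.1 hY
    · exact ptSat_empty ψ
    · exact h hφ
  | dep l ψ _ _ =>
    simp only [PTSat, CSat, iff_true]
    intro Y hY _
    obtain rfl | rfl := Set.subset_singleton_iff_eq.1 hY
    · exact .inl (ptSat_empty ψ)
    · simpa using em _

/-- Classical satisfaction only depends on the variables occurring in the formula. -/
theorem cSat_congr {n : ℕ} {φ : PTForm} {v w : Val} (hφ : VarsBelow n φ)
    (h : restrict n v = restrict n w) : CSat v φ ↔ CSat w φ := by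
  induction φ using PTForm.induction with
  | var p =>
    simp only [VarsBelow] at hφ
    have hp : v p = w p := congrFun h ⟨p, hφ⟩
    simp [CSat, hp]
  | bot => simp [CSat]
  | top => simp [CSat]
  | neg φ ih => simp only [VarsBelow] at hφ; simp [CSat, ih hφ]
  | conj φ ψ ihφ ihψ => simp only [VarsBelow] at hφ; simp [CSat, ihφ hφ.1, ihψ hφ.2]
  | tensor φ ψ ihφ ihψ => simp only [VarsBelow] at hφ; simp [CSat, ihφ hφ.1, ihψ hφ.2]
  | disj φ ψ ihφ ihψ => simp only [VarsBelow] at hφ; simp [CSat, ihφ hφ.1, ihψ hφ.2]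
  | impl φ ψ ihφ ihψ => simp only [VarsBelow] at hφ; simp [CSat, ihφ hφ.1, ihψ hφ.2]
  | dep l ψ _ _ => simp [CSat]

theorem cSat_literal {n : ℕ} {x : Fin n → Bool} {v : Val} :
    CSat v (literal n x) ↔ restrict n v = x := by
  have key : ∀ l : List (Fin n),
      CSat v (l.foldr (fun i acc =>
        .conj (if x i then .var i.val else .neg (.var i.val)) acc) .top) ↔
      ∀ i ∈ l, v i = x i := by
    intro l
    induction l with
    | nil => simp [CSat]
    | cons i l ih => cases hx : x i <;> simp [CSat, ih, hx]
  simp [literal, key, funext_iff, restrict]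

theorem cSat_bigDisj {v : Val} {l : List PTForm} :
    CSat v (bigDisj l) ↔ ∃ φ ∈ l, CSat v φ := by
  induction l with
  | nil => simp [bigDisj, CSat]
  | cons φ l ih => rw [bigDisj] at ih; simp [bigDisj, CSat, ih]

theorem cSat_Theta {n : ℕ} {X : Set (Fin n → Bool)} {v : Val} :
    CSat v (Theta n X) ↔ restrict n v ∈ X := by
  unfold Theta
  split_ifs with h
  · simp [CSat, h]
  · simp [CSat, cSat_bigDisj, cSat_literal]

theorem flat_iff {φ : PTForm} : Flat φ ↔ ∀ X : Team, (∀ v ∈ X, PTSat {v} φ) → PTSat X φ :=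
  forall_congr' fun _ =>
    ⟨fun h => h.2, fun h => ⟨fun hX _ hv => hX.mono (Set.singleton_subset_iff.2 hv), h⟩⟩

theorem flat_var (p : ℕ) : Flat (.var p) := fun X => by simp [PTSat]

theorem flat_neg (φ : PTForm) : Flat (.neg φ) := fun X => by simp [PTSat]

theorem Flat.conj {φ ψ : PTForm} (hφ : Flat φ) (hψ : Flat ψ) : Flat (.conj φ ψ) := fun X => by
  simp only [PTSat, hφ X, hψ X, forall_and]

theorem Flat.impl {φ ψ : PTForm} (hψ : Flat ψ) : Flat (.impl φ ψ) := by
  refine flat_iff.2 fun X h => ?_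
  simp only [PTSat] at h ⊢
  refine fun Y hY hφ => (hψ Y).2 fun v hv => ?_
  exact h v (hY hv) {v} subset_rfl (hφ.mono (Set.singleton_subset_iff.2 hv))

theorem flat_Theta (n : ℕ) (X : Set (Fin n → Bool)) : Flat (Theta n X) := by
  unfold Theta
  split_ifs
  · exact fun Y => by simp [PTSat, Set.eq_empty_iff_forall_notMem]
  · exact flat_neg _

theorem PTEquiv.flat {φ ψ : PTForm} (h : PTEquiv φ ψ) (hψ : Flat ψ) : Flat φ := fun X => by
  simp only [h X, hψ X, fun v => h {v}]

theorem flat_prucnal {φ : PTForm} (hφ : Flat φ) (n : ℕ) (x : Fin n → Bool) :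
    FlatSubst (prucnal φ n x) := by
  intro p
  unfold prucnal
  split_ifs
  exacts [(flat_var p).impl, hφ.conj (flat_var p), flat_var p]

/-- A team satisfies `σ(φ)` exactly if its image under `σ` satisfies `φ`. -/
theorem ptSat_applySubst {σ : Subst} (hσ : FlatSubst σ) {φ : PTForm} :
    ∀ {X : Team}, PTSat X (applySubst σ φ) ↔ PTSat (teamSub σ X) φ := by
  have single : ∀ v, teamSub σ {v} = {valSub σ v} := fun v => Set.image_singleton
  have negIff : ∀ {φ : PTForm}, (∀ {X : Team}, PTSat X (applySubst σ φ) ↔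
      PTSat (teamSub σ X) φ) → ∀ X : Team,
      (∀ v ∈ X, ¬ PTSat {v} (applySubst σ φ)) ↔ ∀ v ∈ teamSub σ X, ¬ PTSat {v} φ := by
    intro φ ih X
    simp only [ih, single]
    exact (Set.forall_mem_image (p := fun v => ¬ PTSat {v} φ)).symm
  induction φ using PTForm.induction with
  | var p =>
    intro X
    simp only [PTSat, applySubst, hσ p X]
    refine Iff.trans ?_ Set.forall_mem_image.symm
    simp [valSub]
  | bot => intro X; simp [PTSat, applySubst, teamSub]
  | top => simp [PTSat, applySubst]
  | neg φ ih => intro X; simpa only [PTSat, applySubst] using negIff ih X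
  | conj φ ψ ihφ ihψ => simp [PTSat, applySubst, ihφ, ihψ]
  | disj φ ψ ihφ ihψ => simp [PTSat, applySubst, ihφ, ihψ]
  | tensor φ ψ ihφ ihψ =>
    intro X
    simp only [PTSat, applySubst, ihφ, ihψ]
    constructor
    · rintro ⟨A, B, rfl, hA, hB⟩
      exact ⟨_, _, Set.image_union _ _ _, hA, hB⟩
    · rintro ⟨A, B, h, hA, hB⟩
      have hpre : ∀ C ⊆ teamSub σ X, teamSub σ (X ∩ valSub σ ⁻¹' C) = C := fun C hC => by
        rw [teamSub, Set.image_inter_preimage]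
        exact Set.inter_eq_right.2 hC
      refine ⟨X ∩ valSub σ ⁻¹' A, X ∩ valSub σ ⁻¹' B, ?_, ?_, ?_⟩
      · rw [← Set.inter_union_distrib_left, ← Set.preimage_union, ← h]
        exact (Set.inter_eq_left.2 (Set.subset_preimage_image _ _)).symm
      · rwa [hpre A (h ▸ Set.subset_union_left)]
      · rwa [hpre B (h ▸ Set.subset_union_right)]
  | impl φ ψ ihφ ihψ =>
    intro X
    simp only [PTSat, applySubst, ihφ, ihψ]
    exact (Set.forall_subset_image_iff (p := fun Y => PTSat Y φ → PTSat Y ψ)).symm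
  | dep l ψ ihl ihψ =>
    intro X
    simp only [PTSat, applySubst]
    refine Iff.trans ?_ Set.forall_subset_image_iff.symm
    refine forall₂_congr fun Y _ => imp_congr ?_ (or_congr ihψ (negIff ihψ Y))
    simp only [List.mem_map, List.mem_attach, true_and, Subtype.exists, forall_exists_index]
    constructor
    · intro h φ hφ
      exact (h _ φ hφ rfl).imp (ihl φ hφ).1 (negIff (ihl φ hφ) Y).1
    · rintro h _ φ hφ rfl
      exact (h φ hφ).imp (ihl φ hφ).2 (negIff (ihl φ hφ) Y).2

theorem valSub_eq_true {σ : Subst} {v : Val} {p : ℕ} :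
    valSub σ v p = true ↔ PTSat {v} (σ p) := by
  simp [valSub]

theorem valSub_prucnal_of_cSat {φ : PTForm} {n : ℕ} {x : Fin n → Bool} {w : Val}
    (hw : CSat w φ) : valSub (prucnal φ n x) w = w := by
  funext p
  rw [Bool.eq_iff_iff, valSub_eq_true, ptSat_singleton_iff, prucnal]
  split_ifs <;> simp [CSat, hw]

theorem restrict_valSub_prucnal_of_not_cSat {φ : PTForm} {n : ℕ} {x : Fin n → Bool} {w : Val}
    (hw : ¬ CSat w φ) : restrict n (valSub (prucnal φ n x) w) = x := by
  funext i
  rw [Bool.eq_iff_iff, restrict, valSub_eq_true, ptSat_singleton_iff, prucnal, dif_pos i.isLt]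
  cases hx : x i <;> simp [CSat, hw]

theorem ptEquiv_Theta_of_flat {n : ℕ} {φ : PTForm} (hvars : VarsBelow n φ) (hφ : Flat φ) :
    PTEquiv φ (Theta n (restrict n '' {v | CSat v φ})) := by
  intro X
  rw [hφ X, flat_Theta n _ X]
  refine forall₂_congr fun v _ => ?_
  rw [ptSat_singleton_iff, ptSat_singleton_iff, cSat_Theta]
  refine ⟨fun h => ⟨v, h, rfl⟩, ?_⟩
  rintro ⟨w, hw, hwv⟩
  exact (cSat_congr hvars hwv).1 hw

theorem fProjective_of_flat {n : ℕ} {φ : PTForm} {v : Val} (hvars : VarsBelow n φ)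
    (hv : CSat v φ) (hφ : Flat φ) : FProjective φ := by
  have hσ := flat_prucnal hφ n (restrict n v)
  refine ⟨prucnal φ n (restrict n v), hσ, fun X => ?_, fun p => ?_⟩
  · rw [ptSat_applySubst hσ, hφ]
    rintro _ ⟨w, -, rfl⟩
    rw [ptSat_singleton_iff]
    by_cases hw : CSat w φ
    · rwa [valSub_prucnal_of_cSat hw]
    · exact (cSat_congr hvars (restrict_valSub_prucnal_of_not_cSat hw)).2 hv
  · have key : ∀ X : Team, PTSat X φ →
        (PTSat X (prucnal φ n (restrict n v) p) ↔ PTSat X (.var p)) := by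
      intro X hX
      rw [hσ p X, flat_var p X]
      refine forall₂_congr fun w hw => ?_
      have hwφ := ptSat_singleton_iff.1 ((hφ X).1 hX w hw)
      rw [← valSub_eq_true, valSub_prucnal_of_cSat hwφ, ptSat_singleton_iff, CSat]
    exact ⟨fun X hX => (key X hX).1, fun X hX => (key X hX).2⟩

theorem flat_of_fProjective {φ : PTForm} (h : FProjective φ) : Flat φ := by
  obtain ⟨σ, hσ, hvalid, hid⟩ := h
  refine flat_iff.2 fun X hX => ?_
  have hfix : ∀ v ∈ X, valSub σ v = v := by
    intro v hv
    funext p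
    have hvar : PTSat {v} (.var p) ↔ v p = true := by rw [ptSat_singleton_iff, CSat]
    rw [Bool.eq_iff_iff, valSub_eq_true, ← hvar]
    exact ⟨(hid p).1 _ (hX v hv), (hid p).2 _ (hX v hv)⟩
  have hteam : teamSub σ X = X := (Set.image_congr hfix).trans (Set.image_id' X)
  rw [← hteam]
  exact (ptSat_applySubst hσ).1 (hvalid X)

/-- Flatness equals projectivity. -/
theorem pt_flat_eq_projective (n : ℕ) (φ : PTForm) (hvars : VarsBelow n φ)
    (hcons : ∃ X : Team, X.Nonempty ∧ PTSat X φ) :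
    [∃ X : Set (Fin n → Bool), X.Nonempty ∧ PTEquiv φ (Theta n X),
     Flat φ,
     FProjective φ].TFAE := by
  obtain ⟨X, ⟨v, hv⟩, hX⟩ := hcons
  have hvφ : CSat v φ := ptSat_singleton_iff.1 (hX.mono (Set.singleton_subset_iff.2 hv))
  tfae_have 1 → 2 := fun ⟨Y, _, h⟩ => h.flat (flat_Theta n Y)
  tfae_have 2 → 1 := fun h =>
    ⟨restrict n '' {w | CSat w φ}, ⟨_, v, hvφ, rfl⟩, ptEquiv_Theta_of_flat hvars h⟩
  tfae_have 2 → 3 := fProjective_of_flat hvars hvφ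
  tfae_have 3 → 2 := flat_of_fProjective
  tfae_finish
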